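/- arXiv:1804.02780 — 7 statements merged into one kernel-verified Lean document; each statement's English description precedes it below -/
import Mathlib

section
/- Let N ≥ 1 and ε ∈ [0,1] be real numbers, let A, B, C be types, let R_h be a finite set of pairs in A × B with |R_h| < N, and let S_l be a finite set of pairs in B × C with |S_l| < N. Assume the light condition on S_l: for every b ∈ B, the fiber {(u,v) ∈ S_l | u = b} has fewer than (3/2)·N^ε elements; and the heavy condition on R_h: for every a ∈ π_A R_h, the fiber {(u,v) ∈ R_h | u = a} has at least (1/2)·N^ε elements. Then the join projection J = {(a,c) | ∃ b, (a,b) ∈ R_h ∧ (b,c) ∈ S_l} satisfies |J| < min{(3/2)·N^(1+ε), 2·N^(2-ε)}, and consequently |J| < 2·N^(1+min{ε,1-ε}). -/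
/-- A join projection has at most as many pairs as there are joining pairs of tuples. -/
theorem card_join_le_sum_card_fiber {A B C : Type*} [DecidableEq B]
    (R : Finset (A × B)) (S : Finset (B × C)) (J : Finset (A × C))
    (hJ : ∀ a c, (a, c) ∈ J → ∃ b, (a, b) ∈ R ∧ (b, c) ∈ S) :
    J.card ≤ ∑ p ∈ R, (S.filter fun q => q.1 = p.2).card := by
  classical
  calc J.card
      ≤ (R.biUnion fun p => (S.filter fun q => q.1 = p.2).image fun q => (p.1, q.2)).card := by
        refine Finset.card_le_card ?_
        rintro ⟨a, c⟩ h
        obtain ⟨b, hab, hbc⟩ := hJ a c h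
        exact Finset.mem_biUnion.2 ⟨(a, b), hab,
          Finset.mem_image.2 ⟨(b, c), Finset.mem_filter.2 ⟨hbc, rfl⟩, rfl⟩⟩
    _ ≤ ∑ p ∈ R, ((S.filter fun q => q.1 = p.2).image fun q => (p.1, q.2)).card :=
        Finset.card_biUnion_le
    _ ≤ ∑ p ∈ R, (S.filter fun q => q.1 = p.2).card :=
        Finset.sum_le_sum fun _ _ => Finset.card_image_le

/-- A join projection has at most `|π_A R| * |S|` pairs. -/
theorem card_join_le_card_image_fst_mul {A B C : Type*} [DecidableEq A]
    (R : Finset (A × B)) (S : Finset (B × C)) (J : Finset (A × C))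
    (hJ : ∀ a c, (a, c) ∈ J → ∃ b, (a, b) ∈ R ∧ (b, c) ∈ S) :
    J.card ≤ (R.image Prod.fst).card * S.card := by
  classical
  calc J.card ≤ (R.image Prod.fst ×ˢ S.image Prod.snd).card := by
        refine Finset.card_le_card ?_
        rintro ⟨a, c⟩ h
        obtain ⟨b, hab, hbc⟩ := hJ a c h
        exact Finset.mem_product.2
          ⟨Finset.mem_image_of_mem Prod.fst hab, Finset.mem_image_of_mem Prod.snd hbc⟩
    _ ≤ (R.image Prod.fst).card * S.card := by
        rw [Finset.card_product]
        exact Nat.mul_le_mul_left _ Finset.card_image_le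

/-- If every nonempty fiber of `R` has at least `t` elements, then `|π_A R| * t ≤ |R|`. -/
theorem card_image_fst_mul_le_card {A B : Type*} [DecidableEq A] (R : Finset (A × B)) (t : ℝ)
    (h : ∀ a ∈ R.image Prod.fst, t ≤ ((R.filter fun p => p.1 = a).card : ℝ)) :
    ((R.image Prod.fst).card : ℝ) * t ≤ R.card := by
  rw [Finset.card_eq_sum_card_image Prod.fst R, Nat.cast_sum, ← nsmul_eq_mul]
  exact Finset.card_nsmul_le_sum _ _ _ h

/-- Size bound for the auxiliary view `V_RS(a,c) = Σ_b R_h(a,b)·S_l(b,c)` in an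
IVM^ε state with threshold base `N`. -/
theorem stmt_3 {A B C : Type*} [DecidableEq A] [DecidableEq B]
    (N ε : ℝ) (hN : 1 ≤ N) (hε0 : 0 ≤ ε) (hε1 : ε ≤ 1)
    (Rh : Finset (A × B)) (Sl : Finset (B × C))
    (hR : (Rh.card : ℝ) < N) (hS : (Sl.card : ℝ) < N)
    (hlight : ∀ b, ((Sl.filter fun p => p.1 = b).card : ℝ) < 3 / 2 * N ^ ε)
    (hheavy : ∀ a ∈ Rh.image Prod.fst,
      (1 / 2 : ℝ) * N ^ ε ≤ ((Rh.filter fun p => p.1 = a).card : ℝ))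
    (J : Finset (A × C))
    (hJ : ∀ a c, (a, c) ∈ J ↔ ∃ b, (a, b) ∈ Rh ∧ (b, c) ∈ Sl) :
    (J.card : ℝ) < min (3 / 2 * N ^ (1 + ε)) (2 * N ^ (2 - ε)) ∧
    (J.card : ℝ) < 2 * N ^ (1 + min ε (1 - ε)) := by
  have hN0 : 0 < N := by linarith
  have hpos : 0 < N ^ ε := Real.rpow_pos_of_pos hN0 ε
  have hpos' : 0 < N ^ (1 - ε) := Real.rpow_pos_of_pos hN0 _
  have e1 : N ^ (1 + ε) = N * N ^ ε := by rw [Real.rpow_add hN0, Real.rpow_one]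
  have e2 : N ^ (2 - ε) = N * N ^ (1 - ε) := by
    rw [show 2 - ε = 1 + (1 - ε) by ring, Real.rpow_add hN0, Real.rpow_one]
  have e3 : N ^ ε * N ^ (1 - ε) = N := by
    rw [← Real.rpow_add hN0, add_sub_cancel, Real.rpow_one]
  have hlt1 : (J.card : ℝ) < 3 / 2 * N ^ (1 + ε) := by
    have h1 : (J.card : ℝ) ≤ ∑ p ∈ Rh, ((Sl.filter fun q => q.1 = p.2).card : ℝ) := by
      exact_mod_cast card_join_le_sum_card_fiber Rh Sl J fun a c => (hJ a c).1
    have h2 : ∑ p ∈ Rh, ((Sl.filter fun q => q.1 = p.2).card : ℝ)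
        ≤ Rh.card * (3 / 2 * N ^ ε) := by
      rw [← nsmul_eq_mul]
      exact Finset.sum_le_card_nsmul _ _ _ fun p _ => (hlight p.2).le
    rw [e1]
    nlinarith
  have hlt2 : (J.card : ℝ) < 2 * N ^ (2 - ε) := by
    have h1 : (J.card : ℝ) ≤ (Rh.image Prod.fst).card * Sl.card := by
      exact_mod_cast card_join_le_card_image_fst_mul Rh Sl J fun a c => (hJ a c).1
    have h2 := card_image_fst_mul_le_card Rh _ hheavy
    have h3 : ((Rh.image Prod.fst).card : ℝ) ≤ 2 * N ^ (1 - ε) := by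
      refine le_of_mul_le_mul_right ?_ hpos
      linarith
    calc (J.card : ℝ) ≤ (Rh.image Prod.fst).card * Sl.card := h1
      _ ≤ 2 * N ^ (1 - ε) * Sl.card := by gcongr
      _ < 2 * N ^ (1 - ε) * N := by gcongr
      _ = 2 * N ^ (2 - ε) := by rw [e2]; ring
  refine ⟨lt_min hlt1 hlt2, ?_⟩
  rcases min_choice ε (1 - ε) with h | h <;> rw [h]
  · have := Real.rpow_pos_of_pos hN0 (1 + ε)
    linarith
  · rwa [show 1 + (1 - ε) = 2 - ε by ring]
end

section
/- Let N ≥ 1 and ε ∈ [0,1] be real numbers, let A, B, C be types. Let R be a finite set of pairs in A × B with |R| < N such that every a ∈ π_A R has fiber {(u,v) ∈ R | u = a} of size at least (1/2)·N^ε (heavy on A) and every b ∈ B has fiber {(u,v) ∈ R | v = b} of size less than (3/2)·N^ε (light on B). Let S be a finite set of pairs in B × C with |S| < N such that every b ∈ B has fiber {(u,v) ∈ S | u = b} of size less than (3/2)·N^ε (light on B) and every c ∈ π_C S has fiber {(u,v) ∈ S | v = c} of size at least (1/2)·N^ε (heavy on C). Then the join projection J = {(a,c) | ∃ b, (a,b)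 ∈ R ∧ (b,c) ∈ S} satisfies |J| ≤ min{2·N^(1+min{ε,1-ε}), 4·N^(2-2ε)}. -/
/-- If every nonempty fiber of `f` on `s` has at least `k` elements, then `f` takes at most
`#s / k` values on `s`. -/
theorem Finset.card_image_mul_le_card_of_le_card_fiber {α β : Type*} [DecidableEq β]
    (s : Finset α) (f : α → β) (k : ℝ)
    (h : ∀ b ∈ s.image f, k ≤ ((s.filter fun x => f x = b).card : ℝ)) :
    ((s.image f).card : ℝ) * k ≤ s.card := by
  rw [Finset.card_eq_sum_card_image f s, Nat.cast_sum, ← nsmul_eq_mul]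
  exact Finset.card_nsmul_le_sum _ _ _ h

/-- A set of fewer than `N` elements all of whose nonempty fibers under `f` have at least
`N ^ ε / 2` elements has an image of size at most `2 * N ^ (1 - ε)`. -/
theorem Finset.card_image_le_of_heavy {α β : Type*} [DecidableEq β]
    (s : Finset α) (f : α → β) {N ε : ℝ} (hN : 0 < N) (hs : (s.card : ℝ) < N)
    (h : ∀ b ∈ s.image f, (1 / 2 : ℝ) * N ^ ε ≤ ((s.filter fun x => f x = b).card : ℝ)) :
    ((s.image f).card : ℝ) ≤ 2 * N ^ (1 - ε) := by
  have hpos : 0 < N ^ ε := Real.rpow_pos_of_pos hN ε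
  have hk := s.card_image_mul_le_card_of_le_card_fiber f _ h
  rw [Real.rpow_sub hN, Real.rpow_one, mul_div_assoc', le_div_iff₀ hpos]
  linarith

/-- If all fibers of `S` over its first coordinate have at most `k` elements, then the join
projection of `R` and `S` has at most `#R * k` elements. -/
theorem Finset.card_join_le_card_mul {A B C : Type*}
    [DecidableEq A] [DecidableEq B] [DecidableEq C]
    (R : Finset (A × B)) (S : Finset (B × C)) (J : Finset (A × C)) (k : ℝ)
    (hJ : ∀ a c, (a, c) ∈ J → ∃ b, (a, b) ∈ R ∧ (b, c) ∈ S)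
    (hS : ∀ b, ((S.filter fun p => p.1 = b).card : ℝ) ≤ k) :
    (J.card : ℝ) ≤ R.card * k := by
  have hsub : J ⊆ R.biUnion fun p => (S.filter fun q => q.1 = p.2).image fun q => (p.1, q.2) := by
    rintro ⟨a, c⟩ hac
    obtain ⟨b, hab, hbc⟩ := hJ a c hac
    exact Finset.mem_biUnion.2 ⟨(a, b), hab,
      Finset.mem_image.2 ⟨(b, c), Finset.mem_filter.2 ⟨hbc, rfl⟩, rfl⟩⟩
  calc (J.card : ℝ)
      ≤ ∑ p ∈ R, (((S.filter fun q => q.1 = p.2).image fun q => (p.1, q.2)).card : ℝ) := by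
        exact_mod_cast (Finset.card_le_card hsub).trans Finset.card_biUnion_le
    _ ≤ ∑ _p ∈ R, k := Finset.sum_le_sum fun p _ =>
        (Nat.cast_le.2 Finset.card_image_le).trans (hS p.2)
    _ = R.card * k := by rw [Finset.sum_const, nsmul_eq_mul]


/-- Size bound for the auxiliary view `V_RS(a,c) = Σ_b R_hl(a,b)·S_lh(b,c)`
under the refined partitioning of IVM^ε. -/
theorem stmt_4 {A B C : Type*} [DecidableEq A] [DecidableEq B] [DecidableEq C]
    (N ε : ℝ) (hN : 1 ≤ N) (hε0 : 0 ≤ ε) (hε1 : ε ≤ 1)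
    (R : Finset (A × B)) (S : Finset (B × C))
    (hR : (R.card : ℝ) < N) (hS : (S.card : ℝ) < N)
    (hRheavyA : ∀ a ∈ R.image Prod.fst,
      (1 / 2 : ℝ) * N ^ ε ≤ ((R.filter fun p => p.1 = a).card : ℝ))
    (hRlightB : ∀ b, ((R.filter fun p => p.2 = b).card : ℝ) < 3 / 2 * N ^ ε)
    (hSlightB : ∀ b, ((S.filter fun p => p.1 = b).card : ℝ) < 3 / 2 * N ^ ε)
    (hSheavyC : ∀ c ∈ S.image Prod.snd,
      (1 / 2 : ℝ) * N ^ ε ≤ ((S.filter fun p => p.2 = c).card : ℝ))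
    (J : Finset (A × C))
    (hJ : ∀ a c, (a, c) ∈ J ↔ ∃ b, (a, b) ∈ R ∧ (b, c) ∈ S) :
    (J.card : ℝ) ≤ min (2 * N ^ (1 + min ε (1 - ε))) (4 * N ^ (2 - 2 * ε)) := by
  have hN0 : 0 < N := by linarith
  have hA := R.card_image_le_of_heavy Prod.fst hN0 hR hRheavyA
  have hC := S.card_image_le_of_heavy Prod.snd hN0 hS hSheavyC
  have hJAC : (J.card : ℝ) ≤ (R.image Prod.fst).card * (S.image Prod.snd).card := by
    have hsub : J ⊆ R.image Prod.fst ×ˢ S.image Prod.snd := by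
      rintro ⟨a, c⟩ hac
      obtain ⟨b, hab, hbc⟩ := (hJ a c).1 hac
      exact Finset.mem_product.2
        ⟨Finset.mem_image_of_mem Prod.fst hab, Finset.mem_image_of_mem Prod.snd hbc⟩
    have hcard := Finset.card_le_card hsub
    rw [Finset.card_product] at hcard
    exact_mod_cast hcard
  have hadd (x y : ℝ) : N ^ (x + y) = N ^ x * N ^ y := Real.rpow_add hN0 x y
  refine le_min ?_ ?_
  · rcases min_choice ε (1 - ε) with h | h <;> rw [h, hadd, Real.rpow_one]
    · have hJR := Finset.card_join_le_card_mul R S J _ (fun a c => (hJ a c).1)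
        fun b => (hSlightB b).le
      have hpos : 0 < N ^ ε := Real.rpow_pos_of_pos hN0 ε
      calc (J.card : ℝ) ≤ R.card * (3 / 2 * N ^ ε) := hJR
        _ ≤ N * (2 * N ^ ε) := by gcongr; norm_num
        _ = 2 * (N * N ^ ε) := by ring
    · have hCS : ((S.image Prod.snd).card : ℝ) ≤ N :=
        (Nat.cast_le.2 Finset.card_image_le).trans hS.le
      calc (J.card : ℝ) ≤ (R.image Prod.fst).card * (S.image Prod.snd).card := hJAC
        _ ≤ (2 * N ^ (1 - ε)) * N := by gcongr
        _ = 2 * (N * N ^ (1 - ε)) := by ring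
  · calc (J.card : ℝ) ≤ (R.image Prod.fst).card * (S.image Prod.snd).card := hJAC
      _ ≤ (2 * N ^ (1 - ε)) * (2 * N ^ (1 - ε)) := by gcongr
      _ = 4 * N ^ (2 - 2 * ε) := by
        rw [show 2 - 2 * ε = (1 - ε) + (1 - ε) by ring, hadd]
        ring
end

section
/- Let N ≥ 1 and ε ∈ [0,1] be real numbers, let A, B, C be types, let S_l be a finite set of pairs in B × C, and let T_h be a finite set of pairs in C × A with |T_h| ≤ N. Assume the light condition on S_l: for every b ∈ B, the fiber {(u,v) ∈ S_l | u = b} has fewer than (3/2)·N^ε elements; and the heavy condition on T_h: for every c ∈ π_C T_h, the fiber {(u,v) ∈ T_h | u = c} has at least (1/2)·N^ε elements. Then for every β ∈ B and α ∈ A, the set {c ∈ C | (β,c) ∈ S_l ∧ (c,α) ∈ T_h} has at most min{(3/2)·N^ε, 2·N^(1-ε)} elements, hence at most 2·N^(min{ε,1-ε}) elements. -/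
/-- If every nonempty fiber of a finite relation has at least `r` elements, then its first
projection times `r` is at most its cardinality. -/
theorem card_image_fst_mul_le_card_s5 {X Y : Type*} [DecidableEq X] (K : Finset (X × Y)) (r : ℝ)
    (h : ∀ x ∈ K.image Prod.fst, r ≤ ((K.filter fun p => p.1 = x).card : ℝ)) :
    ((K.image Prod.fst).card : ℝ) * r ≤ K.card := by
  rw [Finset.card_eq_sum_card_image Prod.fst K, Nat.cast_sum, ← nsmul_eq_mul]
  exact Finset.card_nsmul_le_sum _ _ _ h

/-- The set of elements related to `x` is no larger than the fiber at `x`. -/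
theorem ncard_setOf_mem_le_card_fiber {X Y : Type*} [DecidableEq X] (K : Finset (X × Y)) (x : X) :
    {y | (x, y) ∈ K}.ncard ≤ (K.filter fun p => p.1 = x).card := by
  rw [← Set.ncard_coe_finset]
  exact Set.ncard_le_ncard_of_injOn (Prod.mk x) (fun y hy => by simpa using hy)
    (Prod.mk_right_injective x).injOn (Finset.finite_toSet _)

/-- Counting bound behind the `O(|D|^min{ε,1-ε})` delta computation time for the
skew-aware view `Q_rlh` in IVM^ε. -/
theorem stmt_5 {A B C : Type*} [DecidableEq B] [DecidableEq C]
    (N ε : ℝ) (hN : 1 ≤ N) (hε0 : 0 ≤ ε) (hε1 : ε ≤ 1)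
    (Sl : Finset (B × C)) (Th : Finset (C × A))
    (hT : (Th.card : ℝ) ≤ N)
    (hlight : ∀ b, ((Sl.filter fun p => p.1 = b).card : ℝ) < 3 / 2 * N ^ ε)
    (hheavy : ∀ c ∈ Th.image Prod.fst,
      (1 / 2 : ℝ) * N ^ ε ≤ ((Th.filter fun p => p.1 = c).card : ℝ)) :
    ∀ (β : B) (α : A),
      ((({c : C | (β, c) ∈ Sl ∧ (c, α) ∈ Th} : Set C).ncard : ℝ) ≤
          min (3 / 2 * N ^ ε) (2 * N ^ (1 - ε))) ∧
      ((({c : C | (β, c) ∈ Sl ∧ (c, α) ∈ Th} : Set C).ncard : ℝ) ≤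
          2 * N ^ (min ε (1 - ε))) := by
  intro β α
  have hN0 : 0 < N := by linarith
  have hpos : 0 < N ^ ε := Real.rpow_pos_of_pos hN0 ε
  have hfin : {c : C | (β, c) ∈ Sl}.Finite :=
    Sl.finite_toSet.preimage (Prod.mk_right_injective β).injOn
  have h1 : (({c : C | (β, c) ∈ Sl ∧ (c, α) ∈ Th} : Set C).ncard : ℝ) ≤ 3 / 2 * N ^ ε := by
    refine le_trans ?_ (hlight β).le
    exact Nat.cast_le.mpr <| (Set.ncard_le_ncard (fun _ hc => hc.1) hfin).trans
      (ncard_setOf_mem_le_card_fiber Sl β)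
  have h2 : (({c : C | (β, c) ∈ Sl ∧ (c, α) ∈ Th} : Set C).ncard : ℝ) ≤ 2 * N ^ (1 - ε) := by
    have hle : ({c : C | (β, c) ∈ Sl ∧ (c, α) ∈ Th} : Set C).ncard ≤
        (Th.image Prod.fst).card := by
      rw [← Set.ncard_coe_finset]
      exact Set.ncard_le_ncard (fun _ hc => Finset.mem_image_of_mem Prod.fst hc.2)
        (Finset.finite_toSet _)
    refine (Nat.cast_le.mpr hle).trans ?_
    have hcard := (card_image_fst_mul_le_card_s5 Th _ hheavy).trans hT
    rw [Real.rpow_sub hN0, Real.rpow_one, ← mul_div_assoc, le_div_iff₀ hpos]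
    linarith
  refine ⟨le_min h1 h2, ?_⟩
  rcases min_choice ε (1 - ε) with h | h <;> rw [h]
  · linarith
  · exact h2
end

section
/- Let A be a finite type, R : A × A → ℤ, α, β ∈ A and m ∈ ℤ, and let R' be the relation with R'(α,β) = R(α,β) + m and R'(x) = R(x) for every x ≠ (α,β). Then Σ_{a,b,c} R'(a,b)·R'(b,c)·R'(c,a) − Σ_{a,b,c} R(a,b)·R(b,c)·R(c,a) = 3·m·Σ_{c} R(β,c)·R(c,α) + (if α = β then 3·m²·R(α,α) + m³ else 0). -/
open Matrix in
theorem Matrix.trace_mul_mul_self {n S : Type*} [Fintype n] [CommSemiring S] (M : Matrix n n S) :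
    (M * M * M).trace = ∑ a, ∑ b, ∑ c, M a b * M b c * M c a := by
  simp only [trace, diag_apply, mul_apply, Finset.sum_mul]
  exact Finset.sum_congr rfl fun a _ => Finset.sum_comm

open Matrix in
theorem Matrix.trace_add_cube {n S : Type*} [Fintype n] [CommRing S] (M N : Matrix n n S) :
    ((M + N) * (M + N) * (M + N)).trace =
      (M * M * M).trace + 3 * (N * (M * M)).trace + 3 * (N * N * M).trace + (N * N * N).trace := by
  have h₁ : (M * N * M).trace = (N * (M * M)).trace := by
    rw [Matrix.mul_assoc, trace_mul_comm, Matrix.mul_assoc]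
  have h₂ : (M * M * N).trace = (N * (M * M)).trace := trace_mul_comm _ _
  have h₃ : (M * N * N).trace = (N * N * M).trace := by
    rw [Matrix.mul_assoc, trace_mul_comm]
  have h₄ : (N * M * N).trace = (N * N * M).trace := by
    rw [trace_mul_comm, Matrix.mul_assoc]
  simp only [add_mul, mul_add, trace_add, h₁, h₂, h₃, h₄, Matrix.mul_assoc N M M]
  ring

/-- Closed-form delta of the self-join triangle count under a single-tuple
update `δR = {(α,β) ↦ m}`. -/
theorem stmt_9 {A : Type*} [Fintype A] [DecidableEq A]
    (R : A × A → ℤ) (α β : A) (m : ℤ) :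
    (∑ a, ∑ b, ∑ c,
        (Function.update R (α, β) (R (α, β) + m)) (a, b) *
          (Function.update R (α, β) (R (α, β) + m)) (b, c) *
          (Function.update R (α, β) (R (α, β) + m)) (c, a)) -
      (∑ a, ∑ b, ∑ c, R (a, b) * R (b, c) * R (c, a)) =
      3 * m * (∑ c, R (β, c) * R (c, α)) +
        (if α = β then 3 * m ^ 2 * R (α, α) + m ^ 3 else 0) := by
  have h_update : (Matrix.of fun a b => Function.update R (α, β) (R (α, β) + m) (a, b)) =
      (Matrix.of fun a b => R (a, b)) + Matrix.single α β m := by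
    ext a b
    by_cases h : a = α ∧ b = β
    · obtain ⟨rfl, rfl⟩ := h
      simp
    · have h' : ¬(α = a ∧ β = b) := fun h' => h ⟨h'.1.symm, h'.2.symm⟩
      simp [Function.update_apply, h, h']
  have h_new := Matrix.trace_mul_mul_self
    (Matrix.of fun a b => Function.update R (α, β) (R (α, β) + m) (a, b))
  have h_old := Matrix.trace_mul_mul_self (Matrix.of fun a b => R (a, b))
  rw [h_update, Matrix.trace_add_cube, h_old, ← h_update] at h_new
  simp only [Matrix.of_apply] at h_new
  rw [← h_new]
  split_ifs with h
  · subst h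
    simp [Matrix.trace_single_mul, Matrix.mul_apply]
    ring
  · simp [Matrix.trace_single_mul, Matrix.mul_apply, Matrix.single_mul_single_of_ne, Ne.symm h]
    ring
end

section
/- Let γ ≥ 0 and m ≥ 0 be real numbers, n a natural number, N : ℕ → ℝ a sequence with N_i ≥ 1 for all i, and c : ℕ → ℝ a sequence with c_i ≥ 0 for all i. Assume that for every i < n with c_i > 0 there exists j ≤ i such that: c_i ≤ γ · N_i^(1+m); N_k = N_i for all k with j ≤ k ≤ i; c_k = 0 for all k with j ≤ k < i; and i − j + 1 ≥ N_i / 4. Then Σ_{i<n} c_i ≤ Σ_{i<n} 4·γ·N_i^m. -/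
/-- Amortization of major rebalancing costs in IVM^ε: a per-step charge of
`4·γ·N_i^m` covers the actual costs. -/
theorem stmt_12 (γ m : ℝ) (hγ : 0 ≤ γ) (hm : 0 ≤ m) (n : ℕ)
    (N c : ℕ → ℝ) (hN : ∀ i, 1 ≤ N i) (hc : ∀ i, 0 ≤ c i)
    (h : ∀ i < n, 0 < c i → ∃ j ≤ i,
      c i ≤ γ * N i ^ (1 + m) ∧
      (∀ k, j ≤ k → k ≤ i → N k = N i) ∧
      (∀ k, j ≤ k → k < i → c k = 0) ∧
      N i / 4 ≤ ((i - j + 1 : ℕ) : ℝ)) :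
    ∑ i ∈ Finset.range n, c i ≤ ∑ i ∈ Finset.range n, 4 * γ * N i ^ m := by
  suffices H : ∀ t ≤ n, ∑ i ∈ Finset.range t, c i ≤ ∑ i ∈ Finset.range t, 4 * γ * N i ^ m from
    H n le_rfl
  intro t
  induction t using Nat.strong_induction_on with
  | _ t ih =>
    intro ht
    rcases t with _ | i
    · simp
    rcases (hc i).eq_or_lt with h0 | hpos
    · have hcharge : 0 ≤ 4 * γ * N i ^ m :=
        mul_nonneg (by positivity) (Real.rpow_nonneg (zero_le_one.trans (hN i)) m)
      rw [Finset.sum_range_succ, Finset.sum_range_succ]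
      linarith [ih i (by lia) (by lia)]
    obtain ⟨j, hji, hcost, hbase, hzero, hlen⟩ := h i (by lia) hpos
    obtain ⟨d, rfl⟩ := Nat.exists_eq_add_of_le hji
    have hNpos : 0 < N (j + d) := zero_lt_one.trans_le (hN _)
    have hcosts : ∑ x ∈ Finset.range (d + 1), c (j + x) = c (j + d) := by
      rw [Finset.sum_range_succ, Finset.sum_eq_zero, zero_add]
      intro x hx
      rw [Finset.mem_range] at hx
      exact hzero _ (by lia) (by lia)
    have hcharges : ∑ x ∈ Finset.range (d + 1), 4 * γ * N (j + x) ^ m =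
        ((d + 1 : ℕ) : ℝ) * (4 * γ * N (j + d) ^ m) := by
      rw [Finset.sum_congr rfl (g := fun _ => 4 * γ * N (j + d) ^ m)]
      · simp
      · intro x hx
        rw [Finset.mem_range] at hx
        rw [hbase (j + x) (by lia) (by lia)]
    rw [Nat.add_sub_cancel_left] at hlen
    rw [Real.rpow_add hNpos, Real.rpow_one] at hcost
    have hγN : 0 ≤ 4 * γ * N (j + d) ^ m := by positivity
    rw [add_assoc, Finset.sum_range_add _ j, Finset.sum_range_add _ j, hcosts, hcharges]
    linarith [ih j (by lia) (by lia), mul_le_mul_of_nonneg_right hlen hγN]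
end

section
/- Let γ ≥ 0 and ε ∈ [0,1] be real numbers and set μ = max{ε, 1−ε}. Let n be a natural number, N : ℕ → ℝ a sequence with N_i ≥ 1 for all i, and c : ℕ → ℝ a sequence with c_i ≥ 0 for all i. Assume that for every i < n with c_i > 0 there exists j ≤ i such that: c_i ≤ γ · N_i^(ε+μ); N_k = N_i for all k with j ≤ k ≤ i; c_k = 0 for all k with j ≤ k < i; and i − j + 1 > N_i^ε / 2. Then Σ_{i<n} c_i ≤ Σ_{i<n} 2·γ·N_i^μ. -/
/-- If every positive `c i` is covered by the charges `d k` over a block `j ≤ k ≤ i` on which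
`c` vanishes before `i`, then the charges cover the total. -/
theorem sum_range_le_sum_range_of_block_le (c d : ℕ → ℝ) (hd : ∀ i, 0 ≤ d i) (n : ℕ)
    (h : ∀ i < n, 0 < c i → ∃ j ≤ i, (∀ k, j ≤ k → k < i → c k = 0) ∧
      c i ≤ ∑ k ∈ Finset.Ico j (i + 1), d k) :
    ∑ i ∈ Finset.range n, c i ≤ ∑ i ∈ Finset.range n, d i := by
  induction n using Nat.strong_induction_on with
  | _ n ih =>
    cases n with
    | zero => simp
    | succ i =>
      by_cases hci : 0 < c i
      · obtain ⟨j, hji, hzero, hle⟩ := h i i.lt_succ_self hci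
        have hprev := ih j (by omega) fun k hk => h k (by omega)
        have hblock : ∑ k ∈ Finset.Ico j i, c k = 0 :=
          Finset.sum_eq_zero fun k hk =>
            hzero k (Finset.mem_Ico.mp hk).1 (Finset.mem_Ico.mp hk).2
        rw [Finset.sum_range_succ, ← Finset.sum_range_add_sum_Ico c hji, hblock,
          ← Finset.sum_range_add_sum_Ico d (show j ≤ i + 1 by omega)]
        linarith
      · have hprev := ih i (by omega) fun k hk => h k (by omega)
        rw [Finset.sum_range_succ, Finset.sum_range_succ]
        linarith [hd i]

/-- Amortization of minor rebalancing costs in IVM^ε: a per-step charge of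
`2·γ·N_i^max{ε,1-ε}` covers the actual costs. -/
theorem stmt_13 (γ ε : ℝ) (hγ : 0 ≤ γ) (hε0 : 0 ≤ ε) (hε1 : ε ≤ 1) (n : ℕ)
    (N c : ℕ → ℝ) (hN : ∀ i, 1 ≤ N i) (hc : ∀ i, 0 ≤ c i)
    (h : ∀ i < n, 0 < c i → ∃ j ≤ i,
      c i ≤ γ * N i ^ (ε + max ε (1 - ε)) ∧
      (∀ k, j ≤ k → k ≤ i → N k = N i) ∧
      (∀ k, j ≤ k → k < i → c k = 0) ∧
      N i ^ ε / 2 < ((i - j + 1 : ℕ) : ℝ)) :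
    ∑ i ∈ Finset.range n, c i ≤
      ∑ i ∈ Finset.range n, 2 * γ * N i ^ max ε (1 - ε) := by
  have hpos : ∀ i, 0 < N i := fun i => zero_lt_one.trans_le (hN i)
  have hcharge : ∀ i, 0 ≤ 2 * γ * N i ^ max ε (1 - ε) := fun i =>
    mul_nonneg (by positivity) (Real.rpow_nonneg (hpos i).le _)
  refine sum_range_le_sum_range_of_block_le c _ hcharge n fun i hi hci => ?_
  obtain ⟨j, hji, hcost, hconst, hzero, hlen⟩ := h i hi hci
  refine ⟨j, hji, hzero, ?_⟩
  have hsum : ∑ k ∈ Finset.Ico j (i + 1), 2 * γ * N k ^ max ε (1 - ε) =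
      ((i - j + 1 : ℕ) : ℝ) * (2 * γ * N i ^ max ε (1 - ε)) := by
    rw [Finset.sum_congr rfl fun k hk => by
      rw [hconst k (Finset.mem_Ico.mp hk).1 (Nat.lt_succ_iff.mp (Finset.mem_Ico.mp hk).2)],
      Finset.sum_const, Nat.card_Ico, nsmul_eq_mul, Nat.sub_add_comm hji]
  rw [hsum]
  calc c i ≤ γ * N i ^ (ε + max ε (1 - ε)) := hcost
    _ = N i ^ ε / 2 * (2 * γ * N i ^ max ε (1 - ε)) := by
      rw [Real.rpow_add (hpos i)]; ring
    _ ≤ _ := mul_le_mul_of_nonneg_right hlen.le (hcharge i)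
end

section
/- Let V be a type (of query variables) and let atoms : V → Finset (Fin 3) assign to each variable a nonempty subset of the three relation symbols, i.e., (atoms x).Nonempty for every x. Call the assignment hierarchical if for all x, y ∈ V, either atoms x ⊆ atoms y, or atoms y ⊆ atoms x, or atoms x ∩ atoms y = ∅. Then the assignment is hierarchical if and only if any two variables whose atom sets have exactly two elements have equal atom sets, i.e., for all x, y with (atoms x).card = 2 and (atoms y).card = 2, atoms x = atoms y. -/
/-- Two nonempty subsets of a three-element type are nested or disjoint iff they are not two
distinct pairs. -/
theorem Finset.subset_or_subset_or_inter_eq_empty_iff_of_fin_three :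
    ∀ s t : Finset (Fin 3), s.Nonempty → t.Nonempty →
      ((s ⊆ t ∨ t ⊆ s ∨ s ∩ t = ∅) ↔ (s.card = 2 → t.card = 2 → s = t)) := by
  decide

/-- A 3R query is hierarchical iff any two variables whose atom sets have
exactly two elements have equal atom sets. -/
theorem stmt_15 {V : Type*} (atoms : V → Finset (Fin 3))
    (h : ∀ x, (atoms x).Nonempty) :
    (∀ x y, atoms x ⊆ atoms y ∨ atoms y ⊆ atoms x ∨ atoms x ∩ atoms y = ∅) ↔
      (∀ x y, (atoms x).card = 2 → (atoms y).card = 2 → atoms x = atoms y) :=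
  forall₂_congr fun x y =>
    Finset.subset_or_subset_or_inter_eq_empty_iff_of_fin_three _ _ (h x) (h y)
end
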